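/- Let ω ∈ (0, 3/16). Then the function φ : ℝ → ℝ defined by φ(x) = 2·√( ω / (1 + √(1 - (16/3)ω)·cosh(2√ω x)) ) is positive and satisfies the one-dimensional equation -φ'' + ωφ - φ³ + φ⁵ = 0 on ℝ. -/

import Mathlib

noncomputable section

/-- Logarithmic derivative of `2 √(ω / D)`. -/
theorem hasDerivAt_two_mul_sqrt_div {ω d x : ℝ} {D : ℝ → ℝ} (hω : 0 < ω) (hD : 0 < D x)
    (h : HasDerivAt D d x) :
    HasDerivAt (fun y => 2 * Real.sqrt (ω / D y))
      (-(2 * Real.sqrt (ω / D x) * d / (2 * D x))) x := by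
  have hu : 0 < ω / D x := div_pos hω hD
  have hs := Real.sqrt_pos.mpr hu
  have hsq : Real.sqrt (ω / D x) ^ 2 = ω / D x := Real.sq_sqrt hu.le
  refine ((((hasDerivAt_const x ω).fun_div h hD.ne').sqrt hu.ne').const_mul 2).congr_deriv ?_
  set r := Real.sqrt (ω / D x)
  rw [eq_div_iff hD.ne'] at hsq
  rw [← hsq]
  field_simp
  ring

/-- The explicit one-dimensional cubic-quintic ground state
`φ(x) = 2 √( ω / (1 + √(1 - (16/3)ω) cosh(2√ω x)) )` is positive and solves
`-φ'' + ωφ - φ³ + φ⁵ = 0` on `ℝ`, for every `ω ∈ (0, 3/16)`. -/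
theorem one_dimensional_ground_state (ω : ℝ) (hω : ω ∈ Set.Ioo (0 : ℝ) (3 / 16))
    (φ : ℝ → ℝ)
    (hφ : ∀ x, φ x =
      2 * Real.sqrt (ω / (1 + Real.sqrt (1 - (16 / 3) * ω) * Real.cosh (2 * Real.sqrt ω * x)))) :
    (∀ x, 0 < φ x) ∧
    ∀ x, -(deriv (deriv φ)) x + ω * φ x - (φ x) ^ 3 + (φ x) ^ 5 = 0 := by
  obtain ⟨hω0, hω1⟩ := hω
  set s := Real.sqrt ω with hs
  set b := Real.sqrt (1 - (16 / 3) * ω) with hb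
  have hs2 : s ^ 2 = ω := Real.sq_sqrt hω0.le
  have hb2 : b ^ 2 = 1 - (16 / 3) * ω := Real.sq_sqrt (by linarith)
  have hb0 : 0 ≤ b := Real.sqrt_nonneg _
  have hD (x : ℝ) : 0 < 1 + b * Real.cosh (2 * s * x) := by
    have := Real.cosh_pos (2 * s * x)
    positivity
  have hφpos (x : ℝ) : 0 < φ x := by
    rw [hφ]
    have := Real.sqrt_pos.mpr (div_pos hω0 (hD x))
    positivity
  refine ⟨hφpos, fun x => ?_⟩
  have hlin (x : ℝ) : HasDerivAt (fun y : ℝ => 2 * s * y) (2 * s) x := by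
    simpa using (hasDerivAt_id x).const_mul (2 * s)
  have hD' (x : ℝ) : HasDerivAt (fun y => 1 + b * Real.cosh (2 * s * y))
      (b * (Real.sinh (2 * s * x) * (2 * s))) x :=
    ((hlin x).cosh.const_mul b).const_add 1
  have hD'' (x : ℝ) : HasDerivAt (fun y => b * (Real.sinh (2 * s * y) * (2 * s)))
      (b * (Real.cosh (2 * s * x) * (2 * s) * (2 * s))) x :=
    ((hlin x).sinh.mul_const (2 * s)).const_mul b
  have hφ' (x : ℝ) : HasDerivAt φ (-(φ x * (b * (Real.sinh (2 * s * x) * (2 * s))) /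
      (2 * (1 + b * Real.cosh (2 * s * x))))) x := by
    have h := hasDerivAt_two_mul_sqrt_div (D := fun y => 1 + b * Real.cosh (2 * s * y))
      hω0 (hD x) (hD' x)
    rwa [← funext hφ, ← hφ x] at h
  have hφ'' := (((hφ' x).fun_mul (hD'' x)).fun_div ((hD' x).const_mul 2)
    (mul_pos two_pos (hD x)).ne').fun_neg
  rw [funext fun y => (hφ' y).deriv, hφ''.deriv]
  have hφ2 : φ x ^ 2 = 4 * ω / (1 + b * Real.cosh (2 * s * x)) := by
    rw [hφ x, mul_pow, Real.sq_sqrt (div_pos hω0 (hD x)).le]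
    ring
  have hsinh := Real.sinh_sq (2 * s * x)
  have hDx := (hD x).ne'
  generalize Real.cosh (2 * s * x) = c at *
  generalize Real.sinh (2 * s * x) = t at *
  rw [show φ x ^ 3 = φ x * φ x ^ 2 by ring, show φ x ^ 5 = φ x * (φ x ^ 2) ^ 2 by ring, hφ2]
  generalize φ x = f
  have hDs : (b * (t * (2 * s))) ^ 2 = 4 * ω * (b * c) ^ 2 - 4 * ω * (1 - 16 / 3 * ω) := by
    rw [show (b * (t * (2 * s))) ^ 2 = 4 * s ^ 2 * b ^ 2 * t ^ 2 by ring, hsinh, hs2, mul_pow, hb2]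
    ring
  have hDc : b * (c * (2 * s) * (2 * s)) = 4 * ω * (b * c) := by
    rw [← hs2]
    ring
  rw [hDc]
  generalize b * (t * (2 * s)) = e at *
  generalize b * c = k at *
  field_simp
  linear_combination -3 * f * hDs
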